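/- Let H be an infinite-dimensional complex Hilbert space, let r and s be positive rational numbers with r + s > 1, and let φ : S(H) → S(H) be a surjective map satisfying σ(|A|^r B |A|^s) = σ(|φ(A)|^r φ(B) |φ(A)|^s) for every A in P₁(H) ∪ {I} and every B ∈ S(H). Then φ is continuous with respect to the operator norm. -/

import Mathlib

/-- The absolute value `|A| = (A* A)^(1/2)`, via the continuous functional calculus. -/
noncomputable def absOp {H : Type*} [NormedAddCommGroup H] [InnerProductSpace ℂ H]
    [CompleteSpace H] (A : H →L[ℂ] H) : H →L[ℂ] H :=
  cfc (fun t : ℝ => Real.sqrt t) (star A * A)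

/-- The power `|A|^r`, via the continuous functional calculus. -/
noncomputable def absPow {H : Type*} [NormedAddCommGroup H] [InnerProductSpace ℂ H]
    [CompleteSpace H] (A : H →L[ℂ] H) (r : ℝ) : H →L[ℂ] H :=
  cfc (fun t : ℝ => t ^ r) (absOp A)

/-- An operator has rank one when its range is a one-dimensional subspace. -/
def IsRankOne {H : Type*} [NormedAddCommGroup H] [InnerProductSpace ℂ H]
    (A : H →L[ℂ] H) : Prop :=
  Module.finrank ℂ (LinearMap.range (A : H →ₗ[ℂ] H)) = 1

/-- A rank-one projection: a self-adjoint idempotent of rank one. -/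
def IsRankOneProjection {H : Type*} [NormedAddCommGroup H] [InnerProductSpace ℂ H]
    [CompleteSpace H] (A : H →L[ℂ] H) : Prop :=
  IsSelfAdjoint A ∧ A * A = A ∧ IsRankOne A

open scoped InnerProductSpace


section helpers

variable {H : Type*} [NormedAddCommGroup H] [InnerProductSpace ℂ H] [CompleteSpace H]

lemma aux_absPow (A : H →L[ℂ] H) (hA : IsSelfAdjoint A) (r : ℝ) (hr : 0 < r) :
    absPow A r = cfc (fun t : ℝ => |t| ^ r) A := by
  have h1 : absOp A = cfc (fun t : ℝ => |t|) A := by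
    unfold absOp
    have h2 : star A * A = cfc (fun t : ℝ => t ^ 2) A := by
      rw [cfc_pow_id A 2, hA.star_eq, sq]
    rw [h2, ← cfc_comp' (fun t : ℝ => Real.sqrt t) (fun t : ℝ => t ^ 2) A
      (Real.continuous_sqrt.continuousOn) (by fun_prop) hA]
    simp only [Real.sqrt_sq_eq_abs]
  unfold absPow
  rw [h1, ← cfc_comp' (fun t : ℝ => t ^ r) (fun t : ℝ => |t|) A
    ((Real.continuous_rpow_const hr.le).continuousOn) (by fun_prop) hA]

lemma aux_absPow_proj (P : H →L[ℂ] H) (hP : IsSelfAdjoint P) (h : P * P = P) (r : ℝ)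
    (hr : 0 < r) : absPow P r = P := by
  rw [aux_absPow P hP r hr]
  conv_rhs => rw [← cfc_id ℝ P hP]
  apply cfc_congr
  intro t ht
  have := (isIdempotentElem_iff_spectrum_subset ℝ P hP).1 h ht
  rcases this with rfl | rfl
  · simp [Real.zero_rpow hr.ne']
  · simp

lemma aux_one (A : H →L[ℂ] H) (hA : IsSelfAdjoint A) (r s : ℝ) (hr : 0 < r) (hs : 0 < s)
    (h : spectrum ℂ (absPow A r * A * absPow A s) ⊆ {1}) : A = 1 := by
  have hc : ∀ {r : ℝ}, 0 < r → Continuous (fun t : ℝ => |t| ^ r) := fun hr =>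
    (Real.continuous_rpow_const hr.le).comp continuous_abs
  have e : absPow A r * A * absPow A s = cfc (fun t : ℝ => |t| ^ r * t * |t| ^ s) A := by
    rw [aux_absPow A hA r hr, aux_absPow A hA s hs,
      cfc_mul (fun t : ℝ => |t| ^ r * t) (fun t => |t| ^ s) A
        (((hc hr).mul continuous_id).continuousOn) ((hc hs).continuousOn),
      cfc_mul (fun t : ℝ => |t| ^ r) (fun t => t) A
        ((hc hr).continuousOn) (continuous_id.continuousOn), cfc_id' ℝ A hA]
  rw [e] at h
  have key : ∀ t ∈ spectrum ℝ A, t = 1 := by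
    intro t ht
    have h1 : (|t| ^ r * t * |t| ^ s) ∈ spectrum ℝ (cfc (fun t : ℝ => |t| ^ r * t * |t| ^ s) A) := by
      rw [cfc_map_spectrum (fun t : ℝ => |t| ^ r * t * |t| ^ s) A hA
        ((((hc hr).mul continuous_id).mul (hc hs)).continuousOn)]
      exact ⟨t, ht, rfl⟩
    have h2 : ((|t| ^ r * t * |t| ^ s : ℝ) : ℂ) = 1 := by
      apply h
      exact (spectrum.algebraMap_mem_iff ℂ).2 h1
    have h3 : |t| ^ r * t * |t| ^ s = 1 := by exact_mod_cast h2
    have p1 : 0 ≤ |t| ^ r := by positivity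
    have p2 : 0 ≤ |t| ^ s := by positivity
    have ht0 : 0 < t := by
      by_contra hn
      push Not at hn
      have : |t| ^ r * t * |t| ^ s ≤ 0 :=
        mul_nonpos_of_nonpos_of_nonneg (mul_nonpos_of_nonneg_of_nonpos p1 hn) p2
      linarith
    rw [abs_of_pos ht0] at h3
    by_contra hne
    rcases lt_or_gt_of_ne hne with hl | hg
    · have a1 := Real.rpow_lt_one ht0.le hl hr
      have a2 := Real.rpow_lt_one ht0.le hl hs
      have b1 : 0 < t ^ r := Real.rpow_pos_of_pos ht0 r
      have b2 : 0 < t ^ s := Real.rpow_pos_of_pos ht0 s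
      have : t ^ r * t < 1 := by nlinarith
      have : 0 < t ^ r * t := by positivity
      nlinarith
    · have a1 := Real.one_lt_rpow hg hr
      have a2 := Real.one_lt_rpow hg hs
      have : 1 < t ^ r * t := by nlinarith
      nlinarith
  rw [← cfc_id ℝ A hA, ← cfc_one ℝ A hA]
  exact cfc_congr fun t ht => by simpa using key t ht

lemma aux_eig (T : H →L[ℂ] H) (v : H) (hv : v ≠ 0) (c : ℂ) (h : T v = c • v) :
    c ∈ spectrum ℂ T := by
  rw [spectrum.mem_iff]
  intro hu
  obtain ⟨u, hu⟩ := hu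
  have h1 : (↑u⁻¹ * ↑u : H →L[ℂ] H) v = v := by simp
  have h2 : (u : H →L[ℂ] H) v = 0 := by
    rw [hu]; simp [h, Algebra.algebraMap_eq_smul_one]
  apply hv
  rw [← h1, ContinuousLinearMap.mul_apply, h2, map_zero]

lemma aux_ro (x : H) (B : H →L[ℂ] H) :
    InnerProductSpace.rankOne ℂ x x * B * InnerProductSpace.rankOne ℂ x x
      = inner ℂ x (B x) • InnerProductSpace.rankOne ℂ x x := by
  ext v
  simp [smul_smul, mul_comm]

lemma aux_spec (x : H) (hx : ‖x‖ = 1) (B : H →L[ℂ] H) :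
    inner ℂ x (B x) ∈
      spectrum ℂ (InnerProductSpace.rankOne ℂ x x * B * InnerProductSpace.rankOne ℂ x x) ∧
    spectrum ℂ (InnerProductSpace.rankOne ℂ x x * B * InnerProductSpace.rankOne ℂ x x)
      ⊆ {0, inner ℂ x (B x)} := by
  have hx0 : x ≠ 0 := by rintro rfl; simp at hx
  rw [aux_ro]
  set c := inner ℂ x (B x)
  set P := InnerProductSpace.rankOne ℂ x x
  constructor
  · apply aux_eig _ x hx0
    simp [P, hx]
  · haveI : Nontrivial H := ⟨x, 0, hx0⟩
    intro z hz
    have hP : P * P = P := InnerProductSpace.isIdempotentElem_rankOne_self hx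
    by_cases hc : c = 0
    · rw [hc, zero_smul, spectrum.zero_eq] at hz
      exact Or.inl hz
    · have := spectrum.unit_smul_eq_smul P (Units.mk0 c hc)
      have e : (Units.mk0 c hc) • P = c • P := rfl
      rw [e] at this
      rw [this] at hz
      obtain ⟨w, hw, rfl⟩ := hz
      rcases IsIdempotentElem.spectrum_subset ℂ hP hw with rfl | rfl
      · left; simp
      · right; simp [Units.smul_def]

lemma aux_sa (x : H) : IsSelfAdjoint (InnerProductSpace.rankOne ℂ x x : H →L[ℂ] H) := by
  rw [ContinuousLinearMap.isSelfAdjoint_iff']; simp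

lemma aux_rop (x : H) (hx : ‖x‖ = 1) :
    IsRankOneProjection (InnerProductSpace.rankOne ℂ x x : H →L[ℂ] H) := by
  have hx0 : x ≠ 0 := by rintro rfl; simp at hx
  refine ⟨aux_sa x, InnerProductSpace.isIdempotentElem_rankOne_self hx, ?_⟩
  have := InnerProductSpace.rank_rankOne (𝕜 := ℂ) hx0 hx0
  unfold IsRankOne
  exact Module.rank_eq_one_iff_finrank_eq_one.1 this

lemma aux_norm (T : H →L[ℂ] H) (hT : IsSelfAdjoint T) (M : ℝ) (hM : 0 ≤ M)
    (h : ∀ y : H, ‖y‖ = 1 → ‖inner ℂ y (T y)‖ ≤ M) : ‖T‖ ≤ M := by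
  rw [ContinuousLinearMap.norm_eq_iSup_rayleighQuotient T hT.isSymmetric]
  refine ciSup_le fun x => ?_
  by_cases hx : x = 0
  · simpa [hx] using hM
  · have hn : ‖x‖ ≠ 0 := norm_ne_zero_iff.2 hx
    have hc : ((‖x‖⁻¹ : ℝ) : ℂ) ≠ 0 := by exact_mod_cast inv_ne_zero hn
    rw [← ContinuousLinearMap.rayleigh_smul T x hc]
    set y := ((‖x‖⁻¹ : ℝ) : ℂ) • x with hy
    have hy1 : ‖y‖ = 1 := by rw [hy, norm_smul]; simp [hn]
    have := h y hy1
    rw [ContinuousLinearMap.rayleighQuotient, ContinuousLinearMap.reApplyInnerSelf_apply, hy1]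
    rw [← inner_conj_symm, RCLike.norm_conj] at this
    simpa using (RCLike.abs_re_le_norm _).trans this

/-- a projection whose compressions of self-adjoint operators have at most one nonzero spectral
value, and fixing the unit vector `y`, is the rank one projection on `y`. -/
lemma aux_rank (Q : H →L[ℂ] H) (hQ : IsSelfAdjoint Q) (hQ2 : Q * Q = Q) (y : H) (hy : ‖y‖ = 1)
    (hQy : Q y = y)
    (h : ∀ C : H →L[ℂ] H, IsSelfAdjoint C → ∃ a : ℂ, spectrum ℂ (Q * C * Q) ⊆ {0, a}) :
    Q = InnerProductSpace.rankOne ℂ y y := by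
  have hy0 : y ≠ 0 := by rintro rfl; simp at hy
  have hyy : inner ℂ y y = (1 : ℂ) := by simp [hy]
  ext v
  rw [InnerProductSpace.rankOne_apply]
  by_contra hne
  set w := Q v - inner ℂ y v • y with hw
  have hw0 : w ≠ 0 := sub_ne_zero.2 hne
  have hQw : Q w = w := by
    have : Q (Q v) = Q v := by rw [← ContinuousLinearMap.mul_apply, hQ2]
    simp [hw, this, hQy]
  have hyw : inner ℂ y w = (0 : ℂ) := by
    have : inner ℂ y (Q v) = (inner ℂ y v : ℂ) := by
      have := hQ.isSymmetric y v
      simp only [ContinuousLinearMap.coe_coe] at this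
      rw [← this, hQy]
    rw [hw, inner_sub_right, inner_smul_right, this, hyy]; simp
  have hwy : inner ℂ w y = (0 : ℂ) := inner_eq_zero_symm.1 hyw
  obtain ⟨a, ha⟩ := h (InnerProductSpace.rankOne ℂ y y - InnerProductSpace.rankOne ℂ w w)
    ((aux_sa y).sub (aux_sa w))
  have h1 := ha (aux_eig _ y hy0 1 (by simp [hQy, hy, hwy]))
  have h2 := ha (aux_eig _ w hw0 (-(‖w‖ ^ 2 : ℝ)) (by
    simp [hQw, hyw]))
  have hwn : 0 < ‖w‖ := norm_pos_iff.2 hw0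
  have h3 : a = 1 := by simpa [eq_comm] using h1
  rw [h3] at h2
  rcases h2 with h2 | h2
  · have : -(‖w‖ ^ 2) = 0 := by exact_mod_cast h2
    nlinarith
  · have : -(‖w‖ ^ 2) = 1 := by exact_mod_cast (Set.mem_singleton_iff.1 h2)
    nlinarith

lemma aux_fix (Q : H →L[ℂ] H) (hQ : IsSelfAdjoint Q) (hQ2 : Q * Q = Q) (y : H) (hy : ‖y‖ = 1)
    (h : (1 : ℂ) ∈ spectrum ℂ (Q * InnerProductSpace.rankOne ℂ y y * Q)) : Q y = y := by
  have hy0 : y ≠ 0 := by rintro rfl; simp at hy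
  haveI : Nontrivial H := ⟨y, 0, hy0⟩
  have hs : ∀ u v : H, inner ℂ (Q u) v = (inner ℂ u (Q v) : ℂ) := fun u v => hQ.isSymmetric u v
  have hQQ : Q (Q y) = Q y := by rw [← ContinuousLinearMap.mul_apply, hQ2]
  have e : Q * InnerProductSpace.rankOne ℂ y y * Q = InnerProductSpace.rankOne ℂ (Q y) (Q y) := by
    ext v
    simp [hs]
  rw [e] at h
  have h1 := spectrum.norm_le_norm_of_mem h
  rw [InnerProductSpace.norm_rankOne] at h1
  simp only [norm_one] at h1
  have h2 : inner ℂ (Q y) (y - Q y) = (0 : ℂ) := by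
    rw [hs, map_sub, hQQ, sub_self, inner_zero_right]
  have h3 := norm_add_sq_eq_norm_sq_add_norm_sq_of_inner_eq_zero (Q y) (y - Q y) h2
  rw [add_sub_cancel, hy] at h3
  have : ‖y - Q y‖ = 0 := by nlinarith [norm_nonneg (y - Q y)]
  exact (sub_eq_zero.1 (norm_eq_zero.1 this)).symm

end helpers

theorem preserver_continuous
    {H : Type*} [NormedAddCommGroup H] [InnerProductSpace ℂ H] [CompleteSpace H]
    (hH : ¬ FiniteDimensional ℂ H)
    (r s : ℚ) (hr : 0 < r) (hs : 0 < s) (hrs : 1 < r + s)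
    (φ : selfAdjoint (H →L[ℂ] H) → selfAdjoint (H →L[ℂ] H))
    (hφ : Function.Surjective φ)
    (hspec : ∀ A : selfAdjoint (H →L[ℂ] H),
      (IsRankOneProjection (A : H →L[ℂ] H) ∨ (A : H →L[ℂ] H) = 1) →
      ∀ B : selfAdjoint (H →L[ℂ] H),
        spectrum ℂ (absPow (A : H →L[ℂ] H) r * (B : H →L[ℂ] H) * absPow (A : H →L[ℂ] H) s) =
        spectrum ℂ (absPow (φ A : H →L[ℂ] H) r * (φ B : H →L[ℂ] H) *
          absPow (φ A : H →L[ℂ] H) s)):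
    Continuous φ := by
  have hr' : (0 : ℝ) < (r : ℝ) := by exact_mod_cast hr
  have hs' : (0 : ℝ) < (s : ℝ) := by exact_mod_cast hs
  haveI : Nontrivial H := by
    by_contra hn
    rw [not_nontrivial_iff_subsingleton] at hn
    exact hH inferInstance
  have habs1 : ∀ t : ℝ, 0 < t → absPow (1 : H →L[ℂ] H) t = 1 := fun t ht =>
    aux_absPow_proj 1 (IsSelfAdjoint.one _) (by simp) t ht
  have hφ1 : ((φ 1 : selfAdjoint (H →L[ℂ] H)) : H →L[ℂ] H) = 1 := by
    apply aux_one _ (φ 1).2 r s hr' hs'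
    rw [← hspec 1 (Or.inr rfl) 1]
    simp [habs1 _ hr', habs1 _ hs', spectrum.one_eq]
  have hσ : ∀ B : selfAdjoint (H →L[ℂ] H),
      spectrum ℂ (B : H →L[ℂ] H) = spectrum ℂ (φ B : H →L[ℂ] H) := by
    intro B
    have := hspec 1 (Or.inr rfl) B
    rw [hφ1] at this
    simpa [habs1 _ hr', habs1 _ hs'] using this
  have hid : ∀ A B : selfAdjoint (H →L[ℂ] H),
      spectrum ℂ (A : H →L[ℂ] H) = spectrum ℂ (B : H →L[ℂ] H) →
      (A : H →L[ℂ] H) * A = A → (B : H →L[ℂ] H) * B = B := by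
    intro A B hAB hA
    haveI : IsStarNormal (A : H →L[ℂ] H) := A.2.isStarNormal
    haveI : IsStarNormal (B : H →L[ℂ] H) := B.2.isStarNormal
    apply (isIdempotentElem_iff_spectrum_subset ℂ (B : H →L[ℂ] H) B.2.isStarNormal).2
    rw [← hAB]
    exact IsIdempotentElem.spectrum_subset ℂ hA
  -- projections
  have hP : ∀ x : H, ‖x‖ = 1 → ∀ B : selfAdjoint (H →L[ℂ] H),
      spectrum ℂ (InnerProductSpace.rankOne ℂ x x * (B : H →L[ℂ] H) *
        InnerProductSpace.rankOne ℂ x x) =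
      spectrum ℂ ((φ ⟨InnerProductSpace.rankOne ℂ x x, aux_sa x⟩ : H →L[ℂ] H) * (φ B : H →L[ℂ] H) *
        (φ ⟨InnerProductSpace.rankOne ℂ x x, aux_sa x⟩ : H →L[ℂ] H)) := by
    intro x hx B
    have hi := InnerProductSpace.isIdempotentElem_rankOne_self (𝕜 := ℂ) hx
    have hi2 := hid ⟨InnerProductSpace.rankOne ℂ x x, aux_sa x⟩ _ (hσ _) hi
    have := hspec ⟨InnerProductSpace.rankOne ℂ x x, aux_sa x⟩ (Or.inl (aux_rop x hx)) B
    rw [aux_absPow_proj _ (φ _).2 hi2 _ hr', aux_absPow_proj _ (φ _).2 hi2 _ hs'] at this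
    rw [← this]
    simp only
    rw [aux_absPow_proj _ (aux_sa x) hi _ hr', aux_absPow_proj _ (aux_sa x) hi _ hs']
  have hmain : ∀ y : H, ‖y‖ = 1 → ∃ x : H, ‖x‖ = 1 ∧ ∀ B : selfAdjoint (H →L[ℂ] H),
      inner ℂ y ((φ B : H →L[ℂ] H) y) = (inner ℂ x ((B : H →L[ℂ] H) x) : ℂ) := by
    intro y hy
    have hy0 : y ≠ 0 := by rintro rfl; simp at hy
    obtain ⟨B₀, hB₀⟩ := hφ ⟨InnerProductSpace.rankOne ℂ y y, aux_sa y⟩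
    have hB₀' : (φ B₀ : H →L[ℂ] H) = InnerProductSpace.rankOne ℂ y y := by rw [hB₀]
    have hBi : (B₀ : H →L[ℂ] H) * B₀ = B₀ := by
      apply hid (φ B₀) B₀ (hσ B₀).symm
      rw [hB₀']
      exact InnerProductSpace.isIdempotentElem_rankOne_self hy
    have hBne : (B₀ : H →L[ℂ] H) ≠ 0 := by
      intro h0
      have h1 : (1 : ℂ) ∈ spectrum ℂ (B₀ : H →L[ℂ] H) := by
        rw [hσ, hB₀']
        exact aux_eig _ y hy0 1 (by simp [hy])
      rw [h0, spectrum.zero_eq] at h1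
      simp at h1
    obtain ⟨v, hv⟩ : ∃ v, (B₀ : H →L[ℂ] H) v ≠ 0 := by
      by_contra hn
      push Not at hn
      exact hBne (ContinuousLinearMap.ext hn)
    obtain ⟨x, hx, hBx⟩ : ∃ x : H, ‖x‖ = 1 ∧ (B₀ : H →L[ℂ] H) x = x := by
      refine ⟨((‖(B₀ : H →L[ℂ] H) v‖⁻¹ : ℝ) : ℂ) • (B₀ : H →L[ℂ] H) v, ?_, ?_⟩
      · rw [norm_smul]; simp [norm_ne_zero_iff.2 hv]
      · rw [map_smul, ← ContinuousLinearMap.mul_apply, hBi]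
    refine ⟨x, hx, ?_⟩
    have hQ2 := hid ⟨InnerProductSpace.rankOne ℂ x x, aux_sa x⟩ _ (hσ _)
      (InnerProductSpace.isIdempotentElem_rankOne_self (𝕜 := ℂ) hx)
    have hPx := hP x hx
    set Q := φ ⟨InnerProductSpace.rankOne ℂ x x, aux_sa x⟩ with hQdef
    have hQy : (Q : H →L[ℂ] H) y = y := by
      apply aux_fix _ Q.2 hQ2 y hy
      rw [← hB₀', ← hPx B₀]
      have := (aux_spec x hx (B₀ : H →L[ℂ] H)).1
      rw [hBx] at this
      simpa [hx] using this
    have hQ : (Q : H →L[ℂ] H) = InnerProductSpace.rankOne ℂ y y := by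
      apply aux_rank _ Q.2 hQ2 y hy hQy
      intro C hC
      obtain ⟨B, hB⟩ := hφ ⟨C, hC⟩
      have h1 := hPx B
      rw [hB] at h1
      refine ⟨inner ℂ x ((B : H →L[ℂ] H) x), ?_⟩
      rw [← h1]
      exact (aux_spec x hx (B : H →L[ℂ] H)).2
    intro B
    have h1 := hPx B
    rw [hQ] at h1
    obtain ⟨a1, a2⟩ := aux_spec x hx (B : H →L[ℂ] H)
    obtain ⟨b1, b2⟩ := aux_spec y hy (φ B : H →L[ℂ] H)
    rw [h1] at a1 a2
    have c1 := b2 a1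
    have c2 := a2 b1
    simp only [Set.mem_insert_iff, Set.mem_singleton_iff] at c1 c2
    grind
  have hlip : LipschitzWith 1 φ := by
    apply LipschitzWith.of_dist_le_mul
    intro A B
    rw [NNReal.coe_one, one_mul, dist_eq_norm, dist_eq_norm, AddSubgroup.coe_norm,
      AddSubgroup.coe_norm]
    refine aux_norm _ (φ A - φ B).2 _ (norm_nonneg _) ?_
    intro y hy
    obtain ⟨x, hx, h⟩ := hmain y hy
    have e : inner ℂ y (((φ A - φ B : selfAdjoint (H →L[ℂ] H)) : H →L[ℂ] H) y) =
        (inner ℂ x (((A - B : selfAdjoint (H →L[ℂ] H)) : H →L[ℂ] H) x) : ℂ) := by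
      simp only [AddSubgroup.coe_sub, ContinuousLinearMap.sub_apply, inner_sub_right, h]
    rw [e]
    refine (norm_inner_le_norm _ _).trans ?_
    rw [hx, one_mul]
    simpa [hx] using ((A - B : selfAdjoint (H →L[ℂ] H)) : H →L[ℂ] H).le_opNorm x
  exact hlip.continuous
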